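/- arXiv:1903.01606 — 2 statements merged into one kernel-verified Lean document; each statement's English description precedes it below -/
import Mathlib

section
/- Let n, ℓ, r ≥ 2 and let H be an n-vertex K_{ℓ+1}^{(r)}-free r-graph on vertex set [n] with exactly t_r(n,ℓ) edges, where t_r(n,ℓ) > 0. Then there is a partition [n] = V₁ ∪ … ∪ V_ℓ with each part of size ⌊n/ℓ⌋ or ⌈n/ℓ⌉ such that H consists precisely of all r-element subsets of [n] that intersect each V_i in at most one vertex. -/
open Finset
open scoped Classical

/-- `turanCount n ℓ r` is `t_r(n,ℓ)`: the number of `r`-element subsets of `[n]`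
that meet each class of the balanced partition of `[n]` into `ℓ` parts
(given by residues modulo `ℓ`) in at most one vertex. -/
def turanCount (n ℓ r : ℕ) : ℕ :=
  ((Finset.univ : Finset (Finset (Fin n))).filter
    (fun A => A.card = r ∧ ∀ x ∈ A, ∀ y ∈ A, x ≠ y → x.val % ℓ ≠ y.val % ℓ)).card

/-- `H` is `K_{ℓ+1}^{(r)}`-free: no `(ℓ+1)`-set `S` such that every pair of distinct
vertices of `S` is covered by an edge of `H`. -/
def KKFree (n ℓ : ℕ) (H : Finset (Finset (Fin n))) : Prop :=
  ¬ ∃ S : Finset (Fin n), S.card = ℓ + 1 ∧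
      ∀ x ∈ S, ∀ y ∈ S, x ≠ y → ∃ e ∈ H, x ∈ e ∧ y ∈ e


/-! ### Elementary symmetric sums of multisets of natural numbers -/

theorem esymm_cons_succ (a : ℕ) (M : Multiset ℕ) (r : ℕ) :
    (a ::ₘ M).esymm (r + 1) = M.esymm (r + 1) + a * M.esymm r := by
  simp [Multiset.esymm, Multiset.powersetCard_cons, Multiset.map_map,
    Multiset.sum_map_mul_left]

theorem esymm_zero_eq_one (M : Multiset ℕ) : M.esymm 0 = 1 := by
  simp [Multiset.esymm]

theorem esymm_pos_of_succ (M : Multiset ℕ) :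
    ∀ r, 0 < M.esymm (r + 1) → 0 < M.esymm r := by
  induction M using Multiset.induction with
  | empty => intro r h; simp [Multiset.esymm, Multiset.powersetCard_zero_right] at h
  | cons a M ih =>
    intro r h
    rw [esymm_cons_succ] at h
    have h1 : 0 < M.esymm r := by
      rcases Nat.eq_zero_or_pos (M.esymm (r + 1)) with h0 | h0
      · rw [h0, zero_add] at h
        exact Nat.pos_of_mul_pos_left h
      · exact ih r h0
    cases r with
    | zero => simp [esymm_zero_eq_one]
    | succ r => rw [esymm_cons_succ]; omega

/-- Any two members of `M` differ by at most one. -/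
def IsBalanced (M : Multiset ℕ) : Prop := ∀ a ∈ M, ∀ b ∈ M, a ≤ b + 1

theorem IsBalanced.mem {M : Multiset ℕ} (hM : IsBalanced M) {a : ℕ} (ha : a ∈ M) :
    a = M.sum / Multiset.card M ∨ a = M.sum / Multiset.card M + 1 := by
  obtain ⟨R, rfl⟩ := Multiset.exists_cons_of_mem ha
  set q := (a ::ₘ R).sum / Multiset.card (a ::ₘ R) with hq
  have h1 : Multiset.card (a ::ₘ R) * q ≤ (a ::ₘ R).sum := Nat.mul_div_le _ _
  have h2 : (a ::ₘ R).sum < Multiset.card (a ::ₘ R) * (q + 1) :=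
    Nat.lt_mul_div_succ _ (by simp)
  rw [Multiset.sum_cons, Multiset.card_cons] at h1 h2
  by_contra hcon
  push Not at hcon
  rcases lt_or_ge a q with h | h
  · have : R.sum ≤ Multiset.card R • q := Multiset.sum_le_card_nsmul _ _ fun x hx => by
      have := hM x (by simp [hx]) a (by simp)
      omega
    simp only [smul_eq_mul] at this
    nlinarith
  · have h3 : q + 2 ≤ a := by omega
    have : Multiset.card R • (q + 1) ≤ R.sum := Multiset.card_nsmul_le_sum fun x hx => by
      have := hM a (by simp) x (by simp [hx])
      omega
    simp only [smul_eq_mul] at this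
    nlinarith

theorem sum_eq_of_mem_pair {M : Multiset ℕ} {q : ℕ} (h : ∀ a ∈ M, a = q ∨ a = q + 1) :
    M = Multiset.replicate (Multiset.card M * (q + 1) - M.sum) q
      + Multiset.replicate (M.sum - Multiset.card M * q) (q + 1)
      ∧ Multiset.card M * q ≤ M.sum ∧ M.sum ≤ Multiset.card M * (q + 1) := by
  induction M using Multiset.induction with
  | empty => simp
  | cons a M ih =>
    obtain ⟨h1, h2, h3⟩ := ih fun b hb => h b (by simp [hb])
    have ha := h a (by simp)
    rw [Multiset.sum_cons, Multiset.card_cons, add_mul, add_mul]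
    refine ⟨?_, by omega, by omega⟩
    conv_lhs => rw [h1]
    rcases ha with rfl | rfl
    · rw [show Multiset.card M * (a + 1) + 1 * (a + 1) - (a + M.sum) = Multiset.card M * (a + 1) - M.sum + 1 by omega,
        show a + M.sum - (Multiset.card M * a + 1 * a) = M.sum - Multiset.card M * a by omega,
        Multiset.replicate_succ, Multiset.cons_add]
    · rw [show Multiset.card M * (q + 1) + 1 * (q + 1) - (q + 1 + M.sum) = Multiset.card M * (q + 1) - M.sum by omega,
        show q + 1 + M.sum - (Multiset.card M * q + 1 * q) = M.sum - Multiset.card M * q + 1 by omega,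
        Multiset.replicate_succ, Multiset.add_cons]

theorem IsBalanced.ext {M N : Multiset ℕ} (hM : IsBalanced M) (hN : IsBalanced N)
    (hc : Multiset.card M = Multiset.card N) (hs : M.sum = N.sum) : M = N := by
  have h1 := (sum_eq_of_mem_pair fun a ha => hM.mem ha).1
  have h2 := (sum_eq_of_mem_pair fun a ha => hN.mem ha).1
  rw [h1, h2, hc, hs]

theorem IsBalanced.mem_floor_or_ceil {M : Multiset ℕ} (hM : IsBalanced M) {a : ℕ} (ha : a ∈ M) :
    a = M.sum / Multiset.card M ∨ a = (M.sum + Multiset.card M - 1) / Multiset.card M := by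
  have h0 : 0 < Multiset.card M := Multiset.card_pos_iff_exists_mem.2 ⟨a, ha⟩
  refine (hM.mem ha).imp_right fun h => ?_
  have h1 := (sum_eq_of_mem_pair fun a ha => hM.mem ha).1
  have h2 := Nat.div_add_mod M.sum (Multiset.card M)
  have h3 := Nat.mod_lt M.sum h0
  have h4 : 0 < M.sum % Multiset.card M := by
    by_contra hcon
    rw [show M.sum - Multiset.card M * (M.sum / Multiset.card M) = 0 by omega] at h1
    rw [h1] at ha
    simp only [Multiset.replicate_zero, add_zero] at ha
    have := Multiset.eq_of_mem_replicate ha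
    omega
  symm
  rw [h]
  apply Nat.div_eq_of_lt_le
  · nlinarith [Nat.sub_add_cancel (show 1 ≤ M.sum + Multiset.card M by omega)]
  · nlinarith [Nat.sub_add_cancel (show 1 ≤ M.sum + Multiset.card M by omega)]

theorem esymm_cons_cons_le {a b : ℕ} (hab : b + 2 ≤ a) (R : Multiset ℕ) (r : ℕ) :
    (a ::ₘ b ::ₘ R).esymm r ≤ ((a - 1) ::ₘ (b + 1) ::ₘ R).esymm r ∧
      (2 ≤ r → 0 < (a ::ₘ b ::ₘ R).esymm r →
        (a ::ₘ b ::ₘ R).esymm r < ((a - 1) ::ₘ (b + 1) ::ₘ R).esymm r) := by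
  obtain ⟨c, rfl⟩ : ∃ c, a = c + 1 := ⟨a - 1, by omega⟩
  simp only [Nat.add_sub_cancel]
  match r with
  | 0 => simp [esymm_zero_eq_one]
  | 1 =>
    have h := esymm_zero_eq_one
    constructor
    · simp only [esymm_cons_succ _ _ 0, h, zero_add]; omega
    · omega
  | r + 2 =>
    simp only [esymm_cons_succ]
    constructor
    · nlinarith [Nat.zero_le (R.esymm r)]
    · intro _ hp
      have h3 : 0 < R.esymm r := by
        by_contra h0
        have h1 : R.esymm (r + 1) = 0 := by
          have := esymm_pos_of_succ R r
          omega
        have h2 : R.esymm (r + 1 + 1) = 0 := by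
          have := esymm_pos_of_succ R (r + 1)
          omega
        have h0 : R.esymm r = 0 := by omega
        simp [h0, h1, h2] at hp
      nlinarith

theorem exists_isBalanced_esymm_le (M : Multiset ℕ) :
    ∃ B, IsBalanced B ∧ Multiset.card B = Multiset.card M ∧ B.sum = M.sum ∧
      ∀ r, M.esymm r ≤ B.esymm r ∧
        (2 ≤ r → 0 < M.esymm r → M.esymm r = B.esymm r → IsBalanced M) := by
  induction hk : (M.map (fun x => x ^ 2)).sum using Nat.strong_induction_on generalizing M with
  | _ k ih =>
    by_cases hM : IsBalanced M
    · exact ⟨M, hM, rfl, rfl, fun r => ⟨le_rfl, fun _ _ _ => hM⟩⟩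
    · unfold IsBalanced at hM
      push Not at hM
      obtain ⟨a, ha, b, hb, hab⟩ := hM
      obtain ⟨M₁, rfl⟩ := Multiset.exists_cons_of_mem ha
      obtain ⟨R, rfl⟩ := Multiset.exists_cons_of_mem
        ((Multiset.mem_cons.1 hb).resolve_left (by omega))
      have hab' : b + 2 ≤ a := by omega
      obtain ⟨B, hB, hBc, hBs, hBr⟩ := ih _ (by
        rw [← hk]
        obtain ⟨c, rfl⟩ : ∃ c, a = c + 1 := ⟨a - 1, by omega⟩
        simp only [Multiset.map_cons, Multiset.sum_cons, Nat.add_sub_cancel]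
        nlinarith) ((a - 1) ::ₘ (b + 1) ::ₘ R) rfl
      refine ⟨B, hB, by simpa using hBc, by simp at hBs ⊢; omega, fun r => ?_⟩
      obtain ⟨h1, h2⟩ := esymm_cons_cons_le hab' R r
      refine ⟨h1.trans (hBr r).1, fun hr hp he => ?_⟩
      have := h2 hr hp
      have := (hBr r).1
      omega

theorem IsBalanced.esymm_le {B M : Multiset ℕ} (hB : IsBalanced B) (hc : Multiset.card M = Multiset.card B)
    (hs : M.sum = B.sum) (r : ℕ) : M.esymm r ≤ B.esymm r ∧
      (2 ≤ r → 0 < M.esymm r → M.esymm r = B.esymm r → IsBalanced M) := by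
  obtain ⟨B', h1, h2, h3, h4⟩ := exists_isBalanced_esymm_le M
  rw [hB.ext h1 (by omega) (by omega)]
  exact h4 r

/-! ### Counting cliques -/

/-- The `r`-cliques of `G` inside the vertex set `s`. -/
noncomputable def cliquesIn {V : Type*} (G : SimpleGraph V) (s : Finset V) (r : ℕ) : Finset (Finset V) :=
  (s.powersetCard r).filter fun A => G.IsClique (A : Set V)

section cliques

variable {V : Type*} {G : SimpleGraph V} {s : Finset V} {A : Finset V} {r : ℕ}

theorem mem_cliquesIn :
    A ∈ cliquesIn G s r ↔ A ⊆ s ∧ #A = r ∧ G.IsClique (A : Set V) := by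
  simp [cliquesIn, and_assoc]

theorem cliquesIn_zero : cliquesIn G s 0 = {∅} := by
  ext A
  rw [mem_cliquesIn, mem_singleton]
  constructor
  · rintro ⟨-, h, -⟩
    exact card_eq_zero.1 h
  · rintro rfl
    simp

theorem cliquesIn_empty_succ : cliquesIn G ∅ (r + 1) = ∅ := by
  refine eq_empty_iff_forall_notMem.2 fun A hA => ?_
  obtain ⟨h1, h2, -⟩ := mem_cliquesIn.1 hA
  simp [subset_empty.1 h1] at h2

theorem insert_mem_cliquesIn {v : V} (hv : v ∈ s) (hA : A ∈ cliquesIn G (s.filter (G.Adj v)) r) :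
    insert v A ∈ cliquesIn G s (r + 1) := by
  obtain ⟨h1, h2, h3⟩ := mem_cliquesIn.1 hA
  have hvA : v ∉ A := fun h => by simpa using h1 h
  refine mem_cliquesIn.2 ⟨insert_subset hv (h1.trans (filter_subset _ _)), ?_, ?_⟩
  · rw [card_insert_of_notMem hvA, h2]
  · rw [coe_insert]
    exact h3.insert fun b hb _ => (mem_filter.1 (h1 hb)).2

theorem card_filter_mem_cliquesIn {v : V} (hv : v ∈ s) :
    #((cliquesIn G s (r + 1)).filter (v ∈ ·)) = #(cliquesIn G (s.filter (G.Adj v)) r) := by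
  symm
  refine card_bij (fun A _ => insert v A) ?_ ?_ ?_
  · intro A hA
    exact mem_filter.2 ⟨insert_mem_cliquesIn hv hA, mem_insert_self _ _⟩
  · intro A hA B hB h
    have hvA : v ∉ A := fun h => by simpa using (mem_cliquesIn.1 hA).1 h
    have hvB : v ∉ B := fun h => by simpa using (mem_cliquesIn.1 hB).1 h
    rw [← erase_insert hvA, ← erase_insert hvB, h]
  · intro B hB
    obtain ⟨hB, hvB⟩ := mem_filter.1 hB
    obtain ⟨h1, h2, h3⟩ := mem_cliquesIn.1 hB
    refine ⟨B.erase v, mem_cliquesIn.2 ⟨?_, ?_, ?_⟩, insert_erase hvB⟩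
    · intro x hx
      obtain ⟨hx, hxB⟩ := mem_erase.1 hx
      exact mem_filter.2 ⟨h1 hxB, h3 hvB hxB hx.symm⟩
    · rw [card_erase_of_mem hvB, h2]; rfl
    · exact h3.subset (by simp)

theorem cliquesIn_adj_eq_empty {v : V} (hv : v ∈ s) (h : cliquesIn G s (r + 1) = ∅) :
    cliquesIn G (s.filter (G.Adj v)) r = ∅ := by
  by_contra hne
  obtain ⟨A, hA⟩ := nonempty_iff_ne_empty.2 hne
  simpa [h] using insert_mem_cliquesIn hv hA

/-- A vertex in the largest number of cliques bounds the number of cliques in terms of its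
neighbourhood; tightness forces every clique to meet the non-neighbours at most once. -/
theorem exists_card_cliquesIn_le (hs : s.Nonempty) (r : ℕ) :
    ∃ v ∈ s,
      #(cliquesIn G s (r + 1)) ≤ #(cliquesIn G (s.filter (G.Adj v)) (r + 1)) +
        #(s.filter (¬ G.Adj v ·)) * #(cliquesIn G (s.filter (G.Adj v)) r) ∧
      (#(cliquesIn G (s.filter (G.Adj v)) (r + 1)) +
        #(s.filter (¬ G.Adj v ·)) * #(cliquesIn G (s.filter (G.Adj v)) r) ≤
          #(cliquesIn G s (r + 1)) →
        ∀ A ∈ cliquesIn G s (r + 1), #(A.filter (¬ G.Adj v ·)) ≤ 1) ∧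
      (0 < #(cliquesIn G s (r + 1)) → 0 < #(cliquesIn G (s.filter (G.Adj v)) r)) := by
  obtain ⟨v, hv, hmax⟩ := exists_max_image s
    (fun u => #((cliquesIn G s (r + 1)).filter (u ∈ ·))) hs
  have hdeg := card_filter_mem_cliquesIn (G := G) (r := r) hv
  have hN : #(cliquesIn G (s.filter (G.Adj v)) (r + 1)) =
      ∑ A ∈ cliquesIn G s (r + 1), if A ⊆ s.filter (G.Adj v) then 1 else 0 := by
    rw [← card_filter]
    congr 1
    ext A
    simp only [mem_filter, mem_cliquesIn]
    constructor
    · rintro ⟨h1, h2⟩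
      exact ⟨⟨h1.trans (filter_subset _ _), h2⟩, h1⟩
    · rintro ⟨⟨-, h2⟩, h1⟩
      exact ⟨h1, h2⟩
  have hU : ∑ u ∈ s.filter (¬ G.Adj v ·), #((cliquesIn G s (r + 1)).filter (u ∈ ·)) =
      ∑ A ∈ cliquesIn G s (r + 1), #(A.filter (¬ G.Adj v ·)) := by
    simp only [card_filter]
    rw [sum_comm]
    refine sum_congr rfl fun A hA => ?_
    rw [← card_filter, ← card_filter]
    congr 1
    ext x
    have := (mem_cliquesIn.1 hA).1
    simp only [mem_filter]
    constructor
    · rintro ⟨⟨_, h⟩, h'⟩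
      exact ⟨h', h⟩
    · rintro ⟨h', h⟩
      exact ⟨⟨this h', h⟩, h'⟩
  have hle : ∑ u ∈ s.filter (¬ G.Adj v ·), #((cliquesIn G s (r + 1)).filter (u ∈ ·)) ≤
      #(s.filter (¬ G.Adj v ·)) * #((cliquesIn G s (r + 1)).filter (v ∈ ·)) := by
    rw [← smul_eq_mul]
    exact sum_le_card_nsmul _ _ _ fun u hu => hmax u (mem_filter.1 hu).1
  rw [hdeg] at hle
  have hone : ∀ A ∈ cliquesIn G s (r + 1), 1 ≤
      (if A ⊆ s.filter (G.Adj v) then 1 else 0) + #(A.filter (¬ G.Adj v ·)) := by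
    intro A hA
    split_ifs with h
    · omega
    · rw [zero_add, Nat.one_le_iff_ne_zero, ← Nat.pos_iff_ne_zero, card_pos]
      rw [not_subset] at h
      obtain ⟨x, hx, hxs⟩ := h
      exact ⟨x, mem_filter.2 ⟨hx, fun h => hxs (mem_filter.2 ⟨(mem_cliquesIn.1 hA).1 hx, h⟩)⟩⟩
  have hsum := sum_le_sum hone
  rw [sum_add_distrib, ← hN, ← hU, ← card_eq_sum_ones] at hsum
  refine ⟨v, hv, by omega, fun htight A hA => ?_, fun hpos => ?_⟩
  · have heq : ∑ A ∈ cliquesIn G s (r + 1), 1 = ∑ A ∈ cliquesIn G s (r + 1),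
        ((if A ⊆ s.filter (G.Adj v) then 1 else 0) + #(A.filter (¬ G.Adj v ·))) := by
      rw [sum_add_distrib, ← hN, ← hU, ← card_eq_sum_ones]
      omega
    have := (sum_eq_sum_iff_of_le hone).1 heq A hA
    omega
  · obtain ⟨A, hA⟩ := card_pos.1 hpos
    obtain ⟨h1, h2, -⟩ := mem_cliquesIn.1 hA
    obtain ⟨x, hx⟩ := card_pos.1 (show 0 < #A by omega)
    rw [← hdeg]
    exact (card_pos.2 ⟨A, mem_filter.2 ⟨hA, hx⟩⟩).trans_le (hmax x (h1 hx))

theorem eq_empty_of_cliquesIn_one (h : cliquesIn G s 1 = ∅) : s = ∅ := by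
  by_contra hne
  obtain ⟨x, hx⟩ := nonempty_iff_ne_empty.2 hne
  have : {x} ∈ cliquesIn G s 1 := mem_cliquesIn.2 (by simp [hx])
  simp [h] at this

theorem exists_isBalanced_card_cliquesIn_le (ℓ : ℕ) :
    ∀ s : Finset V, cliquesIn G s (ℓ + 1) = ∅ →
      ∃ M, IsBalanced M ∧ Multiset.card M = ℓ ∧ M.sum = #s ∧
        ∀ r, #(cliquesIn G s r) ≤ M.esymm r := by
  induction ℓ with
  | zero =>
    intro s hs
    obtain rfl := eq_empty_of_cliquesIn_one hs
    refine ⟨0, by simp [IsBalanced], rfl, rfl, fun r => ?_⟩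
    cases r with
    | zero => simp [cliquesIn_zero, esymm_zero_eq_one]
    | succ r => simp [cliquesIn_empty_succ]
  | succ ℓ ih =>
    intro s hs
    obtain ⟨B, hB, hBc, hBs, -⟩ := exists_isBalanced_esymm_le (#s ::ₘ Multiset.replicate ℓ 0)
    simp only [Multiset.card_cons, Multiset.card_replicate, Multiset.sum_cons,
      Multiset.sum_replicate, smul_zero, add_zero] at hBc hBs
    refine ⟨B, hB, hBc, hBs, fun r => ?_⟩
    cases r with
    | zero => simp [cliquesIn_zero, esymm_zero_eq_one]
    | succ r =>
      rcases s.eq_empty_or_nonempty with rfl | hne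
      · simp [cliquesIn_empty_succ]
      obtain ⟨v, hv, hle, -⟩ := exists_card_cliquesIn_le (G := G) hne r
      obtain ⟨M, hM, hMc, hMs, hMr⟩ := ih _ (cliquesIn_adj_eq_empty hv hs)
      have h1 := (hB.esymm_le (M := #(s.filter (¬ G.Adj v ·)) ::ₘ M)
        (by simp [hMc, hBc]) (by
          rw [Multiset.sum_cons, hMs, hBs, add_comm]
          exact card_filter_add_card_filter_not _) (r + 1)).1
      rw [esymm_cons_succ] at h1
      exact hle.trans ((Nat.add_le_add (hMr _) (Nat.mul_le_mul_left _ (hMr _))).trans h1)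

/-- Extremal `K_{ℓ+1}`-free graphs for the number of `r`-cliques, all of whose edges lie in
`r`-cliques, are `ℓ`-colourable. -/
theorem exists_coloring_of_esymm_le_card_cliquesIn (ℓ : ℕ) :
    ∀ (s : Finset V) (r : ℕ) (B : Multiset ℕ), 2 ≤ r → cliquesIn G s (ℓ + 1) = ∅ →
      IsBalanced B → Multiset.card B = ℓ → B.sum = #s → 0 < B.esymm r →
      B.esymm r ≤ #(cliquesIn G s r) →
      (∀ x ∈ s, ∀ y ∈ s, G.Adj x y → ∃ A ∈ cliquesIn G s r, x ∈ A ∧ y ∈ A) →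
      ∃ f : V → ℕ, (∀ x ∈ s, f x < ℓ) ∧ ∀ x ∈ s, ∀ y ∈ s, G.Adj x y → f x ≠ f y := by
  induction ℓ with
  | zero =>
    intro s r B _ hs _ _ _ _ _ _
    obtain rfl := eq_empty_of_cliquesIn_one hs
    exact ⟨0, by simp, by simp⟩
  | succ ℓ ih =>
    intro s r B hr hs hB hBc hBs hpos hle hcov
    obtain ⟨r, rfl⟩ : ∃ k, r = k + 1 := ⟨r - 1, by omega⟩
    have hne : s.Nonempty := by
      obtain ⟨A, hA⟩ := card_pos.1 (hpos.trans_le hle)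
      obtain ⟨h1, h2, -⟩ := mem_cliquesIn.1 hA
      exact (card_pos.1 (show 0 < #A by omega)).mono h1
    obtain ⟨v, hv, hvle, hvtight, hvpos⟩ := exists_card_cliquesIn_le (G := G) hne r
    have hNfree := cliquesIn_adj_eq_empty hv hs
    obtain ⟨M, hM, hMc, hMs, hMr⟩ := exists_isBalanced_card_cliquesIn_le ℓ _ hNfree
    have h1 := (hB.esymm_le (M := #(s.filter (¬ G.Adj v ·)) ::ₘ M)
      (by simp [hMc, hBc]) (by
        rw [Multiset.sum_cons, hMs, hBs, add_comm]
        exact card_filter_add_card_filter_not _) (r + 1)).1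
    rw [esymm_cons_succ] at h1
    have hUpos : 0 < #(s.filter (¬ G.Adj v ·)) := card_pos.2 ⟨v, by simp [hv]⟩
    have h2 := hMr (r + 1)
    have h3 := Nat.mul_le_mul_left #(s.filter (¬ G.Adj v ·)) (hMr r)
    have h4 : M.esymm (r + 1) ≤ #(cliquesIn G (s.filter (G.Adj v)) (r + 1)) := by omega
    have h5 : M.esymm r ≤ #(cliquesIn G (s.filter (G.Adj v)) r) :=
      Nat.le_of_mul_le_mul_left (by omega) hUpos
    have hmeet := hvtight (by omega)
    have hNpos := hvpos (by omega)
    have hN : ∃ f : V → ℕ, (∀ x ∈ s.filter (G.Adj v), f x < ℓ) ∧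
        ∀ x ∈ s.filter (G.Adj v), ∀ y ∈ s.filter (G.Adj v), G.Adj x y → f x ≠ f y := by
      rcases (show r = 1 ∨ 2 ≤ r by omega) with rfl | hr2
      · have hpair : ∀ x ∈ s.filter (G.Adj v), ∀ y ∈ s.filter (G.Adj v), G.Adj x y →
            {x, y} ∈ cliquesIn G (s.filter (G.Adj v)) 2 := by
          intro x hx y hy hxy
          refine mem_cliquesIn.2 ⟨insert_subset hx (singleton_subset_iff.2 hy),
            card_pair hxy.ne, ?_⟩
          rw [coe_pair, SimpleGraph.isClique_pair]
          exact fun _ => hxy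
        rcases Nat.eq_zero_or_pos (M.esymm 2) with h0 | h0
        · have hempty : cliquesIn G (s.filter (G.Adj v)) 2 = ∅ := by
            rw [← card_eq_zero]
            have := hMr 2
            omega
          refine ⟨0, fun x hx => Nat.pos_of_ne_zero ?_, fun x hx y hy hxy => ?_⟩
          · rintro rfl
            rw [eq_empty_of_cliquesIn_one hNfree] at hx
            simp at hx
          · have := hpair x hx y hy hxy
            simp [hempty] at this
        · exact ih _ 2 M le_rfl hNfree hM hMc hMs h0 h4 fun x hx y hy hxy =>
            ⟨_, hpair x hx y hy hxy, by simp, by simp⟩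
      · refine ih _ r M hr2 hNfree hM hMc hMs (hNpos.trans_le (hMr r)) h5
          fun x hx y hy hxy => ?_
        obtain ⟨A, hA, hxA, hyA⟩ := hcov x (mem_filter.1 hx).1 y (mem_filter.1 hy).1 hxy
        obtain ⟨hAs, hAc, hAcl⟩ := mem_cliquesIn.1 hA
        have hA1 := hmeet A hA
        obtain ⟨z, hzA, hz, hzx, hzy⟩ :
            ∃ z ∈ A, (∀ w ∈ A, ¬ G.Adj v w → w = z) ∧ z ≠ x ∧ z ≠ y := by
          rcases (A.filter (¬ G.Adj v ·)).eq_empty_or_nonempty with h0 | ⟨z, hz⟩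
          · obtain ⟨z, hz⟩ : (A \ {x, y}).Nonempty := by
              rw [← card_pos]
              have := le_card_sdiff {x, y} A
              have := card_le_two (a := x) (b := y)
              omega
            simp only [mem_sdiff, mem_insert, mem_singleton, not_or] at hz
            refine ⟨z, hz.1, fun w hw hvw => ?_, hz.2⟩
            have : w ∈ A.filter (¬ G.Adj v ·) := mem_filter.2 ⟨hw, hvw⟩
            simp [h0] at this
          · refine ⟨z, (mem_filter.1 hz).1, fun w hw hvw =>
              card_le_one.1 hA1 w (mem_filter.2 ⟨hw, hvw⟩) z hz, ?_, ?_⟩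
            · rintro rfl
              exact (mem_filter.1 hz).2 (mem_filter.1 hx).2
            · rintro rfl
              exact (mem_filter.1 hz).2 (mem_filter.1 hy).2
        refine ⟨A.erase z, mem_cliquesIn.2 ⟨fun w hw => ?_, ?_, hAcl.subset (by simp)⟩,
          mem_erase.2 ⟨hzx.symm, hxA⟩, mem_erase.2 ⟨hzy.symm, hyA⟩⟩
        · obtain ⟨hwz, hwA⟩ := mem_erase.1 hw
          refine mem_filter.2 ⟨hAs hwA, ?_⟩
          by_contra hvw
          exact hwz (hz w hwA hvw)
        · rw [card_erase_of_mem hzA, hAc]; rfl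
    obtain ⟨f, hf, hfadj⟩ := hN
    refine ⟨fun x => if G.Adj v x then f x else ℓ, fun x hx => ?_, fun x hx y hy hxy => ?_⟩
    · dsimp only
      split_ifs with h
      · exact (hf x (mem_filter.2 ⟨hx, h⟩)).trans (Nat.lt_succ_self _)
      · exact Nat.lt_succ_self _
    · dsimp only
      split_ifs with hvx hvy hvy
      · exact hfadj x (mem_filter.2 ⟨hx, hvx⟩) y (mem_filter.2 ⟨hy, hvy⟩) hxy
      · exact (hf x (mem_filter.2 ⟨hx, hvx⟩)).ne
      · exact (hf y (mem_filter.2 ⟨hy, hvy⟩)).ne'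
      · obtain ⟨A, hA, hxA, hyA⟩ := hcov x hx y hy hxy
        exact absurd (card_le_one.1 (hmeet A hA) x (mem_filter.2 ⟨hxA, hvx⟩) y
          (mem_filter.2 ⟨hyA, hvy⟩)) hxy.ne

end cliques

/-! ### Rainbow sets -/

theorem card_rainbow {V ι : Type*} [Fintype V] [DecidableEq V] [Fintype ι] [DecidableEq ι] (f : V → ι) (r : ℕ) :
    #{A : Finset V | #A = r ∧ ∀ x ∈ A, ∀ y ∈ A, x ≠ y → f x ≠ f y} =
      ((univ : Finset ι).val.map fun i => #{v | f v = i}).esymm r := by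
  rw [Finset.esymm_map_val]
  rw [card_eq_sum_card_fiberwise (f := fun A => A.image f) (t := powersetCard r univ)]
  · refine sum_congr rfl fun t ht => ?_
    rw [← card_pi t fun i => ({v | f v = i} : Finset V)]
    symm
    refine card_bij (fun g _ => t.attach.image fun i => g i.1 i.2) ?_ ?_ ?_
    · intro g hg
      have hg' : ∀ i (hi : i ∈ t), f (g i hi) = i := fun i hi => by
        simpa using mem_pi.1 hg i hi
      have hinj : Function.Injective fun i : t => g i.1 i.2 := by
        intro i j hij
        have := congrArg f hij
        simp only [hg'] at this
        exact Subtype.ext this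
      simp only [mem_filter, mem_univ, true_and]
      refine ⟨⟨?_, ?_⟩, ?_⟩
      · rw [card_image_of_injective _ hinj, card_attach]
        exact (mem_powersetCard.1 ht).2
      · intro x hx y hy hxy hf
        obtain ⟨i, -, rfl⟩ := mem_image.1 hx
        obtain ⟨j, -, rfl⟩ := mem_image.1 hy
        rw [hg', hg'] at hf
        exact hxy (by rw [Subtype.ext hf])
      · rw [image_image]
        ext i
        simp [hg']
    · intro g hg g' hg' h
      funext i hi
      have h1 : g i hi ∈ t.attach.image fun i => g' i.1 i.2 := by
        rw [← h]
        exact mem_image.2 ⟨⟨i, hi⟩, mem_attach _ _, rfl⟩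
      obtain ⟨⟨j, hj⟩, -, hji⟩ := mem_image.1 h1
      have e1 : f (g i hi) = i := by simpa using mem_pi.1 hg i hi
      have e2 : f (g' j hj) = j := by simpa using mem_pi.1 hg' j hj
      have hij : i = j := by rw [← e1, ← hji, e2]
      subst hij
      exact hji.symm
    · intro A hA
      simp only [mem_filter, mem_univ, true_and] at hA
      obtain ⟨⟨-, hA⟩, rfl⟩ := hA
      have hex : ∀ i (hi : i ∈ A.image f), ∃ x ∈ A, f x = i := fun i hi => mem_image.1 hi
      choose g hgA hgf using hex
      refine ⟨g, mem_pi.2 fun i hi => by simp [hgf], ?_⟩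
      ext x
      constructor
      · intro hx
        obtain ⟨i, -, rfl⟩ := mem_image.1 hx
        exact hgA _ _
      · intro hx
        refine mem_image.2 ⟨⟨f x, mem_image_of_mem f hx⟩, mem_attach _ _, ?_⟩
        by_contra hne
        exact hA _ (hgA _ _) _ hx hne (hgf _ _)
  · intro A hA
    simp only [coe_filter, mem_univ, true_and, Set.mem_ofPred_eq] at hA
    rw [mem_coe, mem_powersetCard]
    refine ⟨subset_univ _, ?_⟩
    rw [card_image_of_injOn, hA.1]
    intro x hx y hy hxy
    by_contra hne
    exact hA.2 x hx y hy hne hxy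

theorem sum_card_fibers {n ℓ : ℕ} (f : Fin n → Fin ℓ) :
    ((univ : Finset (Fin ℓ)).val.map fun i => #{v | f v = i}).sum = n := by
  have := card_eq_sum_card_fiberwise (f := f) (s := univ) (t := univ) (by simp [Set.MapsTo])
  rw [card_univ, Fintype.card_fin] at this
  exact this.symm

theorem isBalanced_mod_fibers (n : ℕ) {ℓ : ℕ} (hℓ : 0 < ℓ) :
    IsBalanced ((univ : Finset (Fin ℓ)).val.map fun i =>
      #{v : Fin n | (⟨v.val % ℓ, Nat.mod_lt _ hℓ⟩ : Fin ℓ) = i}) := by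
  have key : ∀ i : Fin ℓ, #{v : Fin n | (⟨v.val % ℓ, Nat.mod_lt _ hℓ⟩ : Fin ℓ) = i} =
      n / ℓ + if i.val % ℓ < n % ℓ then 1 else 0 := by
    intro i
    rw [← Nat.count_modEq_card n hℓ, Nat.count_eq_card_filter_range]
    refine card_bij (fun v _ => v.val) ?_ ?_ ?_
    · intro v hv
      simp only [mem_filter, mem_univ, true_and, Fin.ext_iff] at hv
      simp [Nat.ModEq, hv, Nat.mod_eq_of_lt i.2]
    · intro a _ b _ h
      exact Fin.ext h
    · intro b hb
      simp only [mem_filter, mem_range, Nat.ModEq, Nat.mod_eq_of_lt i.2] at hb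
      exact ⟨⟨b, hb.1⟩, by simp [Fin.ext_iff, hb.2], rfl⟩
  intro a ha b hb
  simp only [key, Multiset.mem_map] at ha hb
  obtain ⟨i, -, rfl⟩ := ha
  obtain ⟨j, -, rfl⟩ := hb
  split_ifs <;> omega

theorem turanCount_eq_esymm (n r : ℕ) {ℓ : ℕ} (hℓ : 0 < ℓ) :
    turanCount n ℓ r = ((univ : Finset (Fin ℓ)).val.map fun i =>
      #{v : Fin n | (⟨v.val % ℓ, Nat.mod_lt _ hℓ⟩ : Fin ℓ) = i}).esymm r := by
  rw [← card_rainbow (fun v : Fin n => (⟨v.val % ℓ, Nat.mod_lt _ hℓ⟩ : Fin ℓ)), turanCount]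
  simp [Fin.ext_iff]

theorem stmt_1 (n ℓ r : ℕ) (hn : 2 ≤ n) (hℓ : 2 ≤ ℓ) (hr : 2 ≤ r)
    (H : Finset (Finset (Fin n))) (hH : ∀ e ∈ H, e.card = r)
    (hfree : KKFree n ℓ H)
    (hcard : H.card = turanCount n ℓ r) (hpos : 0 < turanCount n ℓ r) :
    ∃ f : Fin n → Fin ℓ,
      (∀ i : Fin ℓ, (Finset.univ.filter fun v => f v = i).card = n / ℓ ∨
          (Finset.univ.filter fun v => f v = i).card = (n + ℓ - 1) / ℓ) ∧
      H = Finset.univ.filter (fun A : Finset (Fin n) =>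
        A.card = r ∧ ∀ x ∈ A, ∀ y ∈ A, x ≠ y → f x ≠ f y) := by
  have hℓ0 : 0 < ℓ := by omega
  let G : SimpleGraph (Fin n) :=
    { Adj := fun x y => x ≠ y ∧ ∃ e ∈ H, x ∈ e ∧ y ∈ e
      symm := ⟨fun x y h => ⟨h.1.symm, by
        obtain ⟨-, e, he, hx, hy⟩ := h
        exact ⟨e, he, hy, hx⟩⟩⟩
      loopless := ⟨fun x h => h.1 rfl⟩ }
  have hHG : H ⊆ cliquesIn G univ r := fun e he =>
    mem_cliquesIn.2 ⟨subset_univ _, hH e he, fun x hx y hy hxy => ⟨hxy, e, he, hx, hy⟩⟩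
  have hG : cliquesIn G univ (ℓ + 1) = ∅ := by
    refine eq_empty_iff_forall_notMem.2 fun S hS => hfree ⟨S, (mem_cliquesIn.1 hS).2.1, ?_⟩
    intro x hx y hy hxy
    exact ((mem_cliquesIn.1 hS).2.2 hx hy hxy).2
  rw [turanCount_eq_esymm n r hℓ0] at hcard hpos
  have hB := isBalanced_mod_fibers n hℓ0
  have hBs := sum_card_fibers fun v : Fin n => (⟨v.val % ℓ, Nat.mod_lt _ hℓ0⟩ : Fin ℓ)
  obtain ⟨f, hf, hfadj⟩ := exists_coloring_of_esymm_le_card_cliquesIn (G := G) ℓ univ r _ hr hG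
    hB (by simp) (by rw [hBs]; simp) hpos (hcard ▸ card_le_card hHG) (by
      rintro x - y - ⟨-, e, he, hx, hy⟩
      exact ⟨e, hHG he, hx, hy⟩)
  let g : Fin n → Fin ℓ := fun x => ⟨f x, hf x (mem_univ x)⟩
  have hsub : H ⊆ Finset.univ.filter (fun A : Finset (Fin n) =>
      A.card = r ∧ ∀ x ∈ A, ∀ y ∈ A, x ≠ y → g x ≠ g y) := by
    intro e he
    refine mem_filter.2 ⟨mem_univ _, hH e he, fun x hx y hy hxy hg => ?_⟩
    exact hfadj x (mem_univ _) y (mem_univ _) ⟨hxy, e, he, hx, hy⟩ (congrArg Fin.val hg)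
  have hgs := sum_card_fibers g
  obtain ⟨h1, h2⟩ := hB.esymm_le (M := (univ : Finset (Fin ℓ)).val.map fun i => #{v | g v = i})
    (by simp) (by rw [hgs, hBs]) r
  have hrainbow : #(Finset.univ.filter (fun A : Finset (Fin n) =>
      A.card = r ∧ ∀ x ∈ A, ∀ y ∈ A, x ≠ y → g x ≠ g y)) =
        ((univ : Finset (Fin ℓ)).val.map fun i => #{v | g v = i}).esymm r := by
    convert card_rainbow g r
  have hle := card_le_card hsub
  rw [hrainbow, hcard] at hle
  refine ⟨g, fun i => ?_, eq_of_subset_of_card_le hsub (by rw [hrainbow, hcard]; exact h1)⟩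
  have := (h2 hr (hpos.trans_le hle) (h1.antisymm hle)).mem_floor_or_ceil
    (Multiset.mem_map_of_mem _ (mem_univ i))
  rw [hgs] at this
  simpa using this
end

section
/- Let G be an n-vertex K_{ℓ+1}-free simple graph and for each i ∈ [ℓ] let k_i denote the number of i-element cliques of G. Then for all 1 ≤ i ≤ j ≤ ℓ one has (k_j / binom(ℓ,j))^i ≤ (k_i / binom(ℓ,i))^j; equivalently, the sequence (k_s / binom(ℓ,s))^{1/s} is nonincreasing in s for 1 ≤ s ≤ ℓ. -/
open Finset
open scoped Classical

/-- A nonnegative log-concave sequence without internal zeros that starts at `1` and vanishes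
beyond `n`. -/
structure LogConcaveUpTo (n : ℕ) (p : ℕ → ℝ) : Prop where
  zero : p 0 = 1
  nonneg : ∀ k, 0 ≤ p k
  eq_zero_of_lt : ∀ k, n < k → p k = 0
  eq_zero_succ : ∀ k, p k = 0 → p (k + 1) = 0
  mul_le_sq : ∀ k, p k * p (k + 2) ≤ p (k + 1) ^ 2

namespace LogConcaveUpTo

variable {n : ℕ} {p : ℕ → ℝ}

lemma mul_le_mul (h : LogConcaveUpTo n p) (k : ℕ) :
    p k * p (k + 3) ≤ p (k + 1) * p (k + 2) := by
  rcases (h.nonneg (k + 1)).eq_or_lt' with h1 | h1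
  · have h2 := h.eq_zero_succ _ h1
    have h3 := h.eq_zero_succ _ h2
    simp_all
  rcases (h.nonneg (k + 2)).eq_or_lt' with h2 | h2
  · have h3 := h.eq_zero_succ _ h2
    simp_all
  have ha := h.mul_le_sq k
  have hb := h.mul_le_sq (k + 1)
  have hc := _root_.mul_le_mul ha hb (mul_nonneg (h.nonneg _) (h.nonneg _)) (sq_nonneg _)
  refine le_of_mul_le_mul_left ?_ (mul_pos h1 h2)
  calc _ = p k * p (k + 2) * (p (k + 1) * p (k + 1 + 2)) := by ring_nf
    _ ≤ _ := hc
    _ = _ := by ring_nf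

lemma pow_succ_le (h : LogConcaveUpTo n p) (k : ℕ) : p (k + 1) ^ k ≤ p k ^ (k + 1) := by
  induction k with
  | zero => simp [h.zero]
  | succ k ih =>
    rcases (h.nonneg (k + 1)).eq_or_lt' with h1 | h1
    · simp [h.eq_zero_succ _ h1, h1]
    refine le_of_mul_le_mul_left ?_ (pow_pos h1 k)
    calc p (k + 1) ^ k * p (k + 1 + 1) ^ (k + 1)
        ≤ p k ^ (k + 1) * p (k + 2) ^ (k + 1) := by
          gcongr
          exact pow_nonneg (h.nonneg _) _
      _ = (p k * p (k + 2)) ^ (k + 1) := by rw [mul_pow]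
      _ ≤ (p (k + 1) ^ 2) ^ (k + 1) :=
          pow_le_pow_left₀ (mul_nonneg (h.nonneg _) (h.nonneg _)) (h.mul_le_sq k) _
      _ = _ := by ring

/-- Maclaurin's inequality for log-concave sequences. -/
lemma pow_le_pow (h : LogConcaveUpTo n p) {i j : ℕ} (hi : 1 ≤ i) (hij : i ≤ j) :
    p j ^ i ≤ p i ^ j := by
  induction j, hij using Nat.le_induction with
  | base => rfl
  | succ j hij ih =>
    refine le_of_pow_le_pow_left₀ (n := j) (by omega) (pow_nonneg (h.nonneg _) _) ?_
    calc (p (j + 1) ^ i) ^ j = (p (j + 1) ^ j) ^ i := by ring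
      _ ≤ (p j ^ (j + 1)) ^ i :=
          pow_le_pow_left₀ (pow_nonneg (h.nonneg _) _) (h.pow_succ_le j) _
      _ = (p j ^ i) ^ (j + 1) := by ring
      _ ≤ (p i ^ j) ^ (j + 1) := pow_le_pow_left₀ (pow_nonneg (h.nonneg _) _) ih _
      _ = _ := by ring

/-- Newton's inequality passes from the normalized elementary symmetric functions of `n` nonnegative
numbers to those of `n + 1` numbers. -/
lemma step (h : LogConcaveUpTo n p) {x : ℝ} (hx : 0 ≤ x) {q : ℕ → ℝ} (hq0 : q 0 = 1)
    (hq : ∀ k, (n + 1 : ℝ) * q (k + 1) = (n - k) * p (k + 1) + (k + 1) * x * p k) :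
    LogConcaveUpTo (n + 1) q := by
  have hn : (0 : ℝ) < n + 1 := by positivity
  have hnn : ∀ k : ℕ, 0 ≤ (n - k : ℝ) * p (k + 1) := fun k => by
    rcases lt_or_ge n (k + 1) with hk | hk
    · simp [h.eq_zero_of_lt _ hk]
    · have : (k + 1 : ℝ) ≤ n := by exact_mod_cast hk
      exact mul_nonneg (by linarith) (h.nonneg _)
  have hnn' : ∀ k : ℕ, 0 ≤ (k + 1 : ℝ) * x * p k := fun k =>
    mul_nonneg (by positivity) (h.nonneg _)
  have hlt : ∀ k, n + 1 < k → q k = 0 := fun k hk => by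
    obtain ⟨k, rfl⟩ : ∃ m, k = m + 1 := ⟨k - 1, by omega⟩
    have := hq k
    rw [h.eq_zero_of_lt (k + 1) (by omega), h.eq_zero_of_lt k (by omega)] at this
    simpa [hn.ne'] using this
  refine ⟨hq0, fun k => ?_, hlt, fun k hk => ?_, fun k => ?_⟩
  · cases k with
    | zero => simp [hq0]
    | succ k =>
      refine (mul_nonneg_iff_of_pos_left hn).1 ?_
      rw [hq k]
      exact add_nonneg (hnn k) (hnn' k)
  · cases k with
    | zero => simp [hq0] at hk
    | succ k =>
      have h1 := hq k
      rw [hk, mul_zero] at h1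
      have h2 : (n - k : ℝ) * p (k + 1) = 0 := by linarith [hnn k, hnn' k]
      have h3 : (k + 1 : ℝ) * x * p k = 0 := by linarith [hnn k, hnn' k]
      have h4 : p (k + 1 + 1) = 0 := by
        rcases eq_or_ne (n : ℝ) k with h5 | h5
        · exact h.eq_zero_of_lt _ (by have : n = k := by exact_mod_cast h5
                                      omega)
        · exact h.eq_zero_succ _ (by simpa [sub_ne_zero.2 h5] using h2)
      have h5 : x * p (k + 1) = 0 := by
        have : (k + 1 : ℝ) ≠ 0 := by positivity
        rcases mul_eq_zero.1 h3 with h6 | h6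
        · simp [(mul_eq_zero.1 h6).resolve_left this]
        · simp [h.eq_zero_succ _ h6]
      have h6 := hq (k + 1)
      rw [h4, mul_assoc, h5] at h6
      simpa [hn.ne'] using h6
  · rcases lt_or_ge n (k + 1) with hk | hk
    · rw [hlt (k + 2) (by omega), mul_zero]
      positivity
    have hk' : (k + 1 : ℝ) ≤ n := by exact_mod_cast hk
    have hA := h.mul_le_sq k
    refine le_of_mul_le_mul_left ?_ (mul_pos hn hn)
    cases k with
    | zero =>
      have e1 := hq 0
      have e2 := hq 1
      simp only [h.zero, hq0, zero_add, Nat.cast_zero, Nat.cast_one, sub_zero] at *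
      have : (n + 1 : ℝ) * (n + 1) * q 1 ^ 2 - (n + 1) * (n + 1) * (1 * q 2) =
          (n ^ 2 - 1) * (p 1 ^ 2 - p 2) + (p 1 - x) ^ 2 := by
        linear_combination ((n + 1 : ℝ) * q 1 + n * p 1 + x) * e1 - (n + 1 : ℝ) * e2
      nlinarith [mul_nonneg (show (0 : ℝ) ≤ n ^ 2 - 1 by nlinarith)
        (show 0 ≤ p 1 ^ 2 - p 2 by linarith), sq_nonneg (p 1 - x)]
    | succ k =>
      have hB := h.mul_le_mul k
      have hC := h.mul_le_sq k
      have e0 := hq k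
      have e1 := hq (k + 1)
      have e2 := hq (k + 2)
      simp only [add_assoc, Nat.reduceAdd, Nat.cast_add, Nat.cast_one, Nat.cast_ofNat] at *
      generalize p k = a, p (k + 1) = b, p (k + 2) = c, p (k + 3) = d, q (k + 1) = u,
        q (k + 2) = v, q (k + 3) = w, (n : ℝ) = N at *
      have hK : (0 : ℝ) ≤ k := by positivity
      generalize (k : ℝ) = K at *
      have : (N + 1) * (N + 1) * v ^ 2 - (N + 1) * (N + 1) * (u * w) =
          ((N - K - 1) ^ 2 - 1) * (c ^ 2 - b * d) + ((K + 2) ^ 2 - 1) * x ^ 2 * (b ^ 2 - a * c)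
          + (K + 1) * (N - K - 2) * x * (b * c - a * d) + (c - x * b) ^ 2 := by
        have e3 : (N + 1) * (N + 1) * v ^ 2 = ((N + 1) * v) ^ 2 := by ring
        have e4 : (N + 1) * (N + 1) * (u * w) = ((N + 1) * u) * ((N + 1) * w) := by ring
        rw [e3, e4, e0, e1, e2]
        ring
      have t1 : 0 ≤ ((N - K - 1) ^ 2 - 1) * (c ^ 2 - b * d) :=
        mul_nonneg (by nlinarith) (by linarith)
      have t2 : 0 ≤ ((K + 2) ^ 2 - 1) * x ^ 2 * (b ^ 2 - a * c) :=
        mul_nonneg (mul_nonneg (by nlinarith) (sq_nonneg x)) (by linarith)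
      have t3 : 0 ≤ (K + 1) * (N - K - 2) * x * (b * c - a * d) :=
        mul_nonneg (mul_nonneg (mul_nonneg (by linarith) (by linarith)) hx) (by linarith)
      linarith [sq_nonneg (c - x * b)]

end LogConcaveUpTo

lemma Multiset.esymm_cons_succ {R : Type*} [CommSemiring R] (a : R) (s : Multiset R) (k : ℕ) :
    (a ::ₘ s).esymm (k + 1) = s.esymm (k + 1) + a * s.esymm k := by
  simp [Multiset.esymm, Multiset.powersetCard_cons, Multiset.sum_map_mul_left]

lemma Multiset.esymm_eq_zero_of_card_lt {R : Type*} [CommSemiring R] {s : Multiset R} {k : ℕ}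
    (h : Multiset.card s < k) : s.esymm k = 0 := by
  simp [Multiset.esymm, Multiset.powersetCard_eq_empty k h]

lemma Multiset.esymm_zero_right {R : Type*} [CommSemiring R] (s : Multiset R) :
    s.esymm 0 = 1 := by
  simp [Multiset.esymm]

lemma LogConcaveUpTo.step_esymm {s : Multiset ℝ} {n : ℕ} (hs : Multiset.card s ≤ n)
    (h : LogConcaveUpTo n fun k => s.esymm k / n.choose k) {a : ℝ} (ha : 0 ≤ a) :
    LogConcaveUpTo (n + 1) fun k => (a ::ₘ s).esymm k / (n + 1).choose k := by
  refine h.step ha (by simp [Multiset.esymm_zero_right]) fun k => ?_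
  simp only [Multiset.esymm_cons_succ]
  have c1 : ((n + 1).choose (k + 1) : ℝ) * (k + 1) = (n + 1) * n.choose k := by
    exact_mod_cast (Nat.add_one_mul_choose_eq n k).symm
  rcases lt_trichotomy n k with hk | rfl | hk
  · simp [Nat.choose_eq_zero_of_lt hk, Nat.choose_eq_zero_of_lt (hk.trans k.lt_succ_self),
      Nat.choose_eq_zero_of_lt (Nat.succ_lt_succ hk)]
  · simp [Multiset.esymm_eq_zero_of_card_lt (Nat.lt_succ_of_le hs)]
    ring
  · have c2 : (n.choose (k + 1) : ℝ) * (k + 1) = n.choose k * (n - k) := by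
      rw [← Nat.cast_sub hk.le]
      exact_mod_cast Nat.choose_succ_right_eq n k
    have hk0 : (k + 1 : ℝ) ≠ 0 := by positivity
    have hn0 : (n + 1 : ℝ) ≠ 0 := by positivity
    have hnk : (n - k : ℝ) ≠ 0 := sub_ne_zero.2 (by exact_mod_cast hk.ne')
    have p1 : (n.choose k : ℝ) ≠ 0 := by exact_mod_cast (Nat.choose_pos hk.le).ne'
    rw [← eq_div_iff hk0] at c1 c2
    rw [c1, c2]
    field_simp

/-- The normalized elementary symmetric functions of at most `n` nonnegative numbers, padded with
zeros to `n` numbers, are log-concave. -/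
lemma Multiset.logConcaveUpTo_esymm (s : Multiset ℝ) (hs : ∀ x ∈ s, 0 ≤ x) {n : ℕ}
    (hn : Multiset.card s ≤ n) : LogConcaveUpTo n fun k => s.esymm k / n.choose k := by
  have key : LogConcaveUpTo (Multiset.card s) fun k => s.esymm k / (Multiset.card s).choose k := by
    clear hn
    induction s using Multiset.induction_on with
    | empty =>
      have h0 : ∀ k, (0 : Multiset ℝ).esymm (k + 1) = 0 := fun k =>
        Multiset.esymm_eq_zero_of_card_lt (by simp)
      refine ⟨by simp [Multiset.esymm_zero_right], fun k => ?_, fun k hk => ?_, ?_, ?_⟩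
      · cases k <;> simp [Multiset.esymm_zero_right]
      · simp [Multiset.esymm_eq_zero_of_card_lt hk]
      · simp
      · simp
    | cons a s ih =>
      rw [Multiset.card_cons]
      exact (ih fun x hx => hs x (Multiset.mem_cons_of_mem hx)).step_esymm le_rfl
        (hs a (Multiset.mem_cons_self a s))
  induction n, hn using Nat.le_induction with
  | base => exact key
  | succ n hn ih =>
    have h0 : ∀ k, (0 ::ₘ s).esymm k = s.esymm k := by
      rintro (_ | k) <;> simp [Multiset.esymm_zero_right, Multiset.esymm_cons_succ]
    simpa only [h0] using ih.step_esymm hn le_rfl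

namespace SimpleGraph

variable {V : Type*} [Fintype V] (G : SimpleGraph V)

/-- The sum over the `k`-cliques of the product of the weights of their vertices. -/
noncomputable def cliqueWeight (k : ℕ) (x : V → ℝ) : ℝ :=
  ∑ S ∈ G.cliqueFinset k, ∏ w ∈ S, x w

/-- The partial derivative of `cliqueWeight` in the direction of the vertex `u`. -/
noncomputable def cliqueWeightDeriv (k : ℕ) (x : V → ℝ) (u : V) : ℝ :=
  ∑ S ∈ G.cliqueFinset k with u ∈ S, ∏ w ∈ S.erase u, x w

variable {G}

lemma cliqueWeight_nonneg (k : ℕ) {x : V → ℝ} (hx : 0 ≤ x) : 0 ≤ G.cliqueWeight k x :=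
  sum_nonneg fun _ _ => prod_nonneg fun w _ => hx w

lemma cliqueWeightDeriv_nonneg (k : ℕ) {x : V → ℝ} (hx : 0 ≤ x) (u : V) :
    0 ≤ G.cliqueWeightDeriv k x u :=
  sum_nonneg fun _ _ => prod_nonneg fun w _ => hx w

lemma cliqueWeightDeriv_eq_zero_of_le {i j : ℕ} (hi : 1 ≤ i) (hij : i ≤ j) {x : V → ℝ}
    (hx : 0 ≤ x) {u : V} (h : G.cliqueWeightDeriv i x u = 0) :
    G.cliqueWeightDeriv j x u = 0 := by
  refine sum_eq_zero fun T hT => ?_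
  rw [mem_filter, mem_cliqueFinset_iff] at hT
  obtain ⟨S, huS, hST, hS⟩ := exists_subsuperset_card_eq (singleton_subset_iff.2 hT.2)
    (n := i) (by simpa using hi) (hT.1.card_eq ▸ hij)
  have h0 := (sum_eq_zero_iff_of_nonneg fun S _ => prod_nonneg fun w _ => hx w).1 h S
    (by
      rw [mem_filter, mem_cliqueFinset_iff]
      exact ⟨⟨hT.1.isClique.subset hST, hS⟩, singleton_subset_iff.1 huS⟩)
  obtain ⟨w, hw, hw0⟩ := prod_eq_zero_iff.1 h0
  exact prod_eq_zero (erase_subset_erase u hST hw) hw0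

lemma cliqueWeight_sub_eq (k : ℕ) {x y : V → ℝ} {u v : V} (huv : u ≠ v) (hadj : ¬ G.Adj u v)
    (hxy : ∀ w, w ≠ u → w ≠ v → y w = x w) :
    G.cliqueWeight k y - G.cliqueWeight k x =
      G.cliqueWeightDeriv k x u * (y u - x u) + G.cliqueWeightDeriv k x v * (y v - x v) := by
  simp only [cliqueWeight, cliqueWeightDeriv, sum_filter, sum_mul, ← sum_sub_distrib,
    ← sum_add_distrib]
  refine sum_congr rfl fun S hS => ?_
  rw [mem_cliqueFinset_iff] at hS
  by_cases hu : u ∈ S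
  · have hv : v ∉ S := fun hv => hadj (hS.isClique hu hv huv)
    have : ∏ w ∈ S.erase u, y w = ∏ w ∈ S.erase u, x w := prod_congr rfl fun w hw =>
      hxy w (ne_of_mem_erase hw) (ne_of_mem_of_not_mem (mem_of_mem_erase hw) hv)
    rw [if_pos hu, if_neg hv, ← mul_prod_erase S y hu, ← mul_prod_erase S x hu, this]
    ring
  · by_cases hv : v ∈ S
    · have : ∏ w ∈ S.erase v, y w = ∏ w ∈ S.erase v, x w := prod_congr rfl fun w hw =>
        hxy w (ne_of_mem_of_not_mem (mem_of_mem_erase hw) hu) (ne_of_mem_erase hw)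
      rw [if_neg hu, if_pos hv, ← mul_prod_erase S y hv, ← mul_prod_erase S x hv, this]
      ring
    · have : ∏ w ∈ S, y w = ∏ w ∈ S, x w := prod_congr rfl fun w hw =>
        hxy w (ne_of_mem_of_not_mem hw hu) (ne_of_mem_of_not_mem hw hv)
      simp [hu, hv, this]

lemma cliqueWeight_eq_esymm (k : ℕ) {x : V → ℝ} {s : Finset V} (hs : G.IsClique s)
    (hx : ∀ w ∉ s, x w = 0) : G.cliqueWeight k x = (s.val.map x).esymm k := by
  rw [Finset.esymm_map_val, cliqueWeight]
  symm
  refine sum_subset (fun S hS => ?_) fun S hS hS' => ?_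
  · rw [mem_powersetCard] at hS
    exact mem_cliqueFinset_iff.2 ⟨hs.subset hS.1, hS.2⟩
  · rw [mem_cliqueFinset_iff] at hS
    have : ¬ S ⊆ s := fun h => hS' (mem_powersetCard.2 ⟨h, hS.card_eq⟩)
    obtain ⟨w, hw, hws⟩ := not_subset.1 this
    exact prod_eq_zero hw (hx w hws)

/-- Moving weight from `v` to a nonadjacent vertex `u` until `v` carries no weight. -/
lemma exists_shift {i j : ℕ} (hi : 1 ≤ i) (hij : i ≤ j) {x : V → ℝ} (hx : 0 ≤ x) {u v : V}
    (huv : u ≠ v) (hadj : ¬ G.Adj u v) (hxu : x u ≠ 0) (hxv : x v ≠ 0)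
    (hu : G.cliqueWeightDeriv i x u = 0 → G.cliqueWeightDeriv i x v = 0)
    (h : G.cliqueWeightDeriv j x v * G.cliqueWeightDeriv i x u ≤
      G.cliqueWeightDeriv i x v * G.cliqueWeightDeriv j x u) :
    ∃ y : V → ℝ, 0 ≤ y ∧ #{w | y w ≠ 0} < #{w | x w ≠ 0} ∧
      G.cliqueWeight i y = G.cliqueWeight i x ∧ G.cliqueWeight j x ≤ G.cliqueWeight j y := by
  set B := G.cliqueWeightDeriv i x u with hB
  set C := G.cliqueWeightDeriv i x v with hC
  have hB0 : 0 ≤ B := cliqueWeightDeriv_nonneg i hx u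
  have hC0 : 0 ≤ C := cliqueWeightDeriv_nonneg i hx v
  have hxv0 : 0 ≤ x v := hx v
  have hxu0 : 0 ≤ x u := hx u
  let y : V → ℝ := Function.update (Function.update x v 0) u (x u + C * x v / B)
  have hyu : y u = x u + C * x v / B := by simp [y]
  have hyv : y v = 0 := by simp [y, huv.symm]
  have hyw : ∀ w, w ≠ u → w ≠ v → y w = x w := fun w h1 h2 => by simp [y, h1, h2]
  refine ⟨y, fun w => ?_, card_lt_card ?_, ?_, ?_⟩
  · rcases eq_or_ne w u with rfl | h1
    · rw [hyu]
      exact add_nonneg hxu0 (div_nonneg (mul_nonneg hC0 hxv0) hB0)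
    · rcases eq_or_ne w v with rfl | h2
      · exact hyv.ge
      · rw [hyw w h1 h2]
        exact hx w
  · refine (ssubset_iff_of_subset fun w hw => ?_).2 ⟨v, by simpa using hxv, by simp [hyv]⟩
    simp only [mem_filter, mem_univ, true_and] at hw ⊢
    rcases eq_or_ne w u with rfl | h1
    · exact hxu
    · rcases eq_or_ne w v with rfl | h2
      · exact absurd hyv hw
      · rwa [← hyw w h1 h2]
  · have := cliqueWeight_sub_eq i huv hadj hyw
    rw [hyu, hyv, ← hB, ← hC] at this
    rcases eq_or_ne B 0 with h0 | h0
    · rw [h0, hu h0] at this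
      linarith
    · have e : B * (x u + C * x v / B - x u) + C * (0 - x v) = 0 := by
        field_simp
        ring
      linarith
  · have := cliqueWeight_sub_eq j huv hadj hyw
    rw [hyu, hyv] at this
    rcases hB0.eq_or_lt' with h0 | h0
    · rw [cliqueWeightDeriv_eq_zero_of_le hi hij hx h0,
        cliqueWeightDeriv_eq_zero_of_le hi hij hx (hu h0)] at this
      linarith
    · have e : G.cliqueWeightDeriv j x u * (x u + C * x v / B - x u) +
          G.cliqueWeightDeriv j x v * (0 - x v) =
          (C * G.cliqueWeightDeriv j x u - G.cliqueWeightDeriv j x v * B) * x v / B := by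
        field_simp
        ring
      have : 0 ≤ (C * G.cliqueWeightDeriv j x u - G.cliqueWeightDeriv j x v * B) * x v / B :=
        div_nonneg (mul_nonneg (by linarith) hxv0) hB0
      linarith

/-- Weighted form of the Fisher-Ryan inequality. -/
lemma CliqueFree.cliqueWeight_div_pow_le {ℓ i j : ℕ} (hG : G.CliqueFree (ℓ + 1)) (hi : 1 ≤ i)
    (hij : i ≤ j) (x : V → ℝ) (hx : 0 ≤ x) :
    (G.cliqueWeight j x / ℓ.choose j) ^ i ≤ (G.cliqueWeight i x / ℓ.choose i) ^ j := by
  induction hm : #{w | x w ≠ 0} using Nat.strong_induction_on generalizing x with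
  | _ m ih =>
  by_cases hcl : G.IsClique (({w | x w ≠ 0} : Finset V) : Set V)
  · have hcard : #{w | x w ≠ 0} ≤ ℓ := by
      by_contra! hlt
      exact hG.mono hlt _ ⟨hcl, rfl⟩
    rw [cliqueWeight_eq_esymm j hcl (by simp), cliqueWeight_eq_esymm i hcl (by simp)]
    refine (Multiset.logConcaveUpTo_esymm (n := ℓ) _ (fun a ha => ?_) ?_).pow_le_pow hi hij
    · obtain ⟨w, -, rfl⟩ := Multiset.mem_map.1 ha
      exact hx w
    · rwa [Multiset.card_map]
  · obtain ⟨y, hy, hlt, hyi, hyj⟩ : ∃ y : V → ℝ, 0 ≤ y ∧ #{w | y w ≠ 0} < #{w | x w ≠ 0} ∧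
        G.cliqueWeight i y = G.cliqueWeight i x ∧ G.cliqueWeight j x ≤ G.cliqueWeight j y := by
      simp only [IsClique, Set.Pairwise, coe_filter, mem_univ, true_and, Set.mem_ofPred_eq] at hcl
      push Not at hcl
      obtain ⟨u, hxu, v, hxv, huv, hadj⟩ := hcl
      have hadj' : ¬ G.Adj v u := fun h => hadj h.symm
      have hz := fun w => cliqueWeightDeriv_eq_zero_of_le (G := G) (u := w) hi hij hx
      by_cases hu : G.cliqueWeightDeriv i x u = 0
      · by_cases hv : G.cliqueWeightDeriv i x v = 0
        · exact exists_shift hi hij hx huv hadj hxu hxv (fun _ => hv) (by simp [hu, hv])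
        · exact exists_shift hi hij hx huv.symm hadj' hxv hxu (fun h => absurd h hv)
            (by simp [hu, hz u hu])
      · by_cases hv : G.cliqueWeightDeriv i x v = 0
        · exact exists_shift hi hij hx huv hadj hxu hxv (fun _ => hv) (by simp [hv, hz v hv])
        · rcases le_total (G.cliqueWeightDeriv j x v * G.cliqueWeightDeriv i x u)
            (G.cliqueWeightDeriv i x v * G.cliqueWeightDeriv j x u) with h | h
          · exact exists_shift hi hij hx huv hadj hxu hxv (fun h => absurd h hu) h
          · exact exists_shift hi hij hx huv.symm hadj' hxv hxu (fun h => absurd h hv)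
              (by linarith)
    calc (G.cliqueWeight j x / ℓ.choose j) ^ i ≤ (G.cliqueWeight j y / ℓ.choose j) ^ i :=
          pow_le_pow_left₀ (div_nonneg (cliqueWeight_nonneg j hx) (Nat.cast_nonneg _))
            (div_le_div_of_nonneg_right hyj (Nat.cast_nonneg _)) i
      _ ≤ (G.cliqueWeight i y / ℓ.choose i) ^ j := ih _ (hm ▸ hlt) y hy rfl
      _ = _ := by rw [hyi]

end SimpleGraph

theorem stmt_7 (n ℓ : ℕ) (G : SimpleGraph (Fin n)) (hfree : G.CliqueFree (ℓ + 1))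
    (k : ℕ → ℕ) (hk : ∀ i, k i = (G.cliqueFinset i).card) :
    ∀ i j : ℕ, 1 ≤ i → i ≤ j → j ≤ ℓ →
      ((k j : ℝ) / (ℓ.choose j : ℝ)) ^ i ≤ ((k i : ℝ) / (ℓ.choose i : ℝ)) ^ j := by
  intro i j hi hij _
  have hw : ∀ m, G.cliqueWeight m 1 = k m := fun m => by
    simp only [SimpleGraph.cliqueWeight, Pi.one_apply, prod_const_one, sum_const, hk,
      nsmul_eq_mul, mul_one]
    congr!
  simpa only [hw] using hfree.cliqueWeight_div_pow_le hi hij 1 zero_le_one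
end
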